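/- arXiv:2402.12684 — 6 statements merged into one kernel-verified Lean document; each statement's English description precedes it below -/
import Mathlib

section
/- Fix n ≥ 1 and let H be the n×n matrix with entries H_{ij} = (i + j − 2)! for 1 ≤ i, j ≤ n (so H_{ij} = ∫₀^∞ x^{i-1} x^{j-1} e^{-x} dx). Then H is invertible and its inverse B has entries B_{ij} = ((-1)^{i+j} / ((i−1)! (j−1)!)) · Σ_{k=max(i,j)}^{n} binom(k−1, i−1) binom(k−1, j−1). -/
open Finset in
theorem sum_range_neg_one_pow_mul_choose_mul_choose (i j m : ℕ) (hm : i < m) :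
    ∑ k ∈ range m, (-1 : ℝ) ^ k * (i.choose k * k.choose j) = if i = j then (-1) ^ i else 0 := by
  induction i generalizing j m with
  | zero =>
    rw [sum_eq_single_of_mem 0 (by simpa using hm)
      (fun k _ hk => by simp [Nat.choose_eq_zero_of_lt (Nat.pos_of_ne_zero hk)])]
    cases j <;> simp
  | succ i ih =>
    obtain ⟨m, rfl⟩ : ∃ m', m = m' + 1 := ⟨m - 1, by omega⟩
    have hsplit : ∑ k ∈ range (m + 1), (-1 : ℝ) ^ k * ((i + 1).choose k * k.choose j) =
        ∑ k ∈ range (m + 1), (-1 : ℝ) ^ k * (i.choose k * k.choose j) -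
          ∑ k ∈ range m, (-1 : ℝ) ^ k * (i.choose k * (k + 1).choose j) := by
      rw [sum_range_succ', sum_range_succ' _ m, add_sub_right_comm, ← sum_sub_distrib]
      congr 1
      · refine sum_congr rfl fun k _ => ?_
        rw [Nat.choose_succ_succ i k]
        push_cast
        ring
      · simp
    rw [hsplit, ih j (m + 1) (by omega)]
    cases j with
    | zero =>
      have h := ih 0 m (by omega)
      simp only [Nat.choose_zero_right] at h ⊢
      rw [h]
      simp
    | succ j =>
      have h : ∑ k ∈ range m, (-1 : ℝ) ^ k * (i.choose k * (k + 1).choose (j + 1)) =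
          (if i = j then (-1) ^ i else 0) + if i = j + 1 then (-1) ^ i else 0 := by
        rw [← ih j m (by omega), ← ih (j + 1) m (by omega), ← sum_add_distrib]
        refine sum_congr rfl fun k _ => ?_
        rw [Nat.choose_succ_succ k j]
        push_cast
        ring
      rw [h]
      by_cases hij : i = j
      · simp [hij, pow_succ]
      · simp [hij]

open Finset in
theorem Nat.add_choose_eq_sum_range_choose_mul_choose (i j m : ℕ) (hm : i < m) :
    (i + j).choose i = ∑ k ∈ range m, i.choose k * j.choose k := by
  rw [Nat.add_choose_eq, ← sum_subset (range_subset_range.2 (Nat.succ_le_of_lt hm)),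
    ← Nat.sum_antidiagonal_eq_sum_range_succ_mk (fun p => i.choose p.1 * j.choose p.1),
    ← Nat.sum_antidiagonal_swap]
  · refine sum_congr rfl fun p hp => ?_
    rw [HasAntidiagonal.mem_antidiagonal] at hp
    simp [Nat.choose_symm_of_eq_add (show i = p.1 + p.2 by omega)]
  · intro k _ hk
    rw [Nat.choose_eq_zero_of_lt (by simpa using hk), zero_mul]

/-- The inverse of the Hankel Gram matrix `H i j = (i + j − 2)!`
(indices running from `1` to `n`) of the monomials with weight `e^{-x}` on `(0, ∞)`. -/
theorem hankel_factorial_inverse (n : ℕ) (hn : 1 ≤ n)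
    (H : Matrix (Fin n) (Fin n) ℝ)
    (hH : ∀ i j : Fin n, H i j = ((i : ℕ) + (j : ℕ)).factorial) :
    IsUnit H ∧
      ∀ i j : Fin n,
        H⁻¹ i j =
          (-1 : ℝ) ^ ((i : ℕ) + (j : ℕ)) /
              (((i : ℕ).factorial : ℝ) * ((j : ℕ).factorial : ℝ)) *
            ∑ k ∈ Finset.univ.filter (fun k : Fin n => max i j ≤ k),
              (((k : ℕ).choose (i : ℕ) : ℝ) * ((k : ℕ).choose (j : ℕ) : ℝ)) := by
  let P : Matrix (Fin n) (Fin n) ℝ :=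
    Matrix.of fun i k => ((i : ℕ).factorial : ℝ) * (i : ℕ).choose k
  let Q : Matrix (Fin n) (Fin n) ℝ :=
    Matrix.of fun k i => (-1 : ℝ) ^ ((k : ℕ) + i) * (k : ℕ).choose i / (i : ℕ).factorial
  have hPP : H = P * P.transpose := by
    ext i j
    have h := Nat.add_choose_eq_sum_range_choose_mul_choose i j n i.2
    have hc : (((i : ℕ) + j).choose i : ℝ) =
        ∑ k : Fin n, ((i : ℕ).choose k : ℝ) * (j : ℕ).choose k := by
      rw [h, ← Fin.sum_univ_eq_sum_range (fun k => (i : ℕ).choose k * (j : ℕ).choose k)]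
      push_cast
      rfl
    rw [hH, ← Nat.add_choose_mul_factorial_mul_factorial, ← Nat.choose_symm_add, Matrix.mul_apply]
    push_cast
    rw [hc, Finset.sum_mul, Finset.sum_mul]
    refine Finset.sum_congr rfl fun k _ => ?_
    simp only [P, Matrix.of_apply, Matrix.transpose_apply]
    ring
  have hPQ : P * Q = 1 := by
    ext i j
    have h := sum_range_neg_one_pow_mul_choose_mul_choose i j n i.2
    rw [← Fin.sum_univ_eq_sum_range
      (fun k => (-1 : ℝ) ^ k * ((i : ℕ).choose k * k.choose (j : ℕ)))] at h
    have hfac : (P * Q) i j = ((i : ℕ).factorial : ℝ) * (-1) ^ (j : ℕ) / (j : ℕ).factorial *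
        if (i : ℕ) = j then (-1) ^ (i : ℕ) else 0 := by
      rw [← h, Matrix.mul_apply, Finset.mul_sum]
      refine Finset.sum_congr rfl fun k _ => ?_
      simp only [P, Q, Matrix.of_apply]
      ring
    rw [hfac, Matrix.one_apply]
    by_cases hij : i = j
    · subst hij
      have hne : ((i : ℕ).factorial : ℝ) ≠ 0 := by positivity
      simp only [if_true]
      field_simp
      rw [← pow_mul, mul_comm, pow_mul]
      simp
    · simp [hij, Fin.val_inj]
  have hQP : Q * P = 1 := mul_eq_one_comm.1 hPQ
  have hHB : H * (Q.transpose * Q) = 1 := by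
    rw [hPP, Matrix.mul_assoc, ← Matrix.mul_assoc P.transpose, ← Matrix.transpose_mul, hQP,
      Matrix.transpose_one, Matrix.one_mul, hPQ]
  refine ⟨IsUnit.of_mul_eq_one _ hHB, fun i j => ?_⟩
  rw [Matrix.inv_eq_right_inv hHB, Matrix.mul_apply, Finset.sum_filter, Finset.mul_sum]
  refine Finset.sum_congr rfl fun k _ => ?_
  simp only [Q, Matrix.of_apply, Matrix.transpose_apply]
  split_ifs with hk
  · have hsq : ((-1 : ℝ) ^ (k : ℕ)) ^ 2 = 1 := by rw [← pow_mul, mul_comm, pow_mul]; simp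
    rw [pow_add, pow_add, pow_add]
    linear_combination ((-1 : ℝ) ^ (i : ℕ) * (-1) ^ (j : ℕ) * (k : ℕ).choose i *
      (k : ℕ).choose j / ((i : ℕ).factorial * (j : ℕ).factorial)) * hsq
  · rw [max_le_iff, not_and_or, not_le, not_le] at hk
    rcases hk with hk | hk <;> simp [Nat.choose_eq_zero_of_lt (Fin.lt_def.1 hk)]
end

section
/- Fix n ≥ 1 and let H be the n×n matrix with entries H_{ij} = (i + j − 2)! for 1 ≤ i, j ≤ n. Then det H = ∏_{k=0}^{n-1} (k!)². -/
/-- Vandermonde's identity in symmetric form. -/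
theorem Nat.sum_range_choose_mul_choose {n i : ℕ} (hi : i < n) (j : ℕ) :
    ∑ k ∈ Finset.range n, i.choose k * j.choose k = (i + j).choose i := by
  rw [← Finset.sum_subset (Finset.range_subset_range.2 (Nat.succ_le_of_lt hi)), Nat.add_comm i j,
    Nat.add_choose_eq, Finset.Nat.sum_antidiagonal_eq_sum_range_succ_mk]
  · refine Finset.sum_congr rfl fun k hk => ?_
    rw [Nat.choose_symm (Nat.lt_succ_iff.1 (Finset.mem_range.1 hk)), Nat.mul_comm]
  · intro k _ hk
    rw [Nat.choose_eq_zero_of_lt (by simpa [Nat.succ_le_iff] using hk), Nat.zero_mul]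

/-- The lower triangular matrix of the numbers `i! * C(i, k)`. -/
def factorialPascal (n : ℕ) : Matrix (Fin n) (Fin n) ℝ :=
  Matrix.of fun i k => ((i : ℕ).factorial : ℝ) * ((i : ℕ).choose k : ℝ)

theorem det_factorialPascal (n : ℕ) :
    (factorialPascal n).det = ∏ k ∈ Finset.range n, (k.factorial : ℝ) := by
  rw [Matrix.det_of_isLowerTriangular, ← Fin.prod_univ_eq_prod_range]
  · simp [factorialPascal]
  · intro i k hik
    have h : (i : ℕ) < k := hik
    simp [factorialPascal, Nat.choose_eq_zero_of_lt h]

theorem factorialPascal_mul_transpose_apply {n : ℕ} (i j : Fin n) :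
    (factorialPascal n * (factorialPascal n).transpose) i j =
      (((i : ℕ) + (j : ℕ)).factorial : ℝ) := by
  have h := Nat.add_choose_mul_factorial_mul_factorial (i : ℕ) (j : ℕ)
  rw [← Nat.choose_symm_add, ← Nat.sum_range_choose_mul_choose i.isLt,
    ← Fin.sum_univ_eq_sum_range (fun k => (i : ℕ).choose k * (j : ℕ).choose k)] at h
  rw [← h, Matrix.mul_apply]
  push_cast
  rw [Finset.sum_mul, Finset.sum_mul]
  refine Finset.sum_congr rfl fun k _ => ?_
  simp only [factorialPascal, Matrix.transpose_apply, Matrix.of_apply]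
  ring

/-- The determinant of the Hankel Gram matrix `H i j = (i + j − 2)!`
(indices running from `1` to `n`) is `∏_{k=0}^{n-1} (k!)²`. -/
theorem hankel_factorial_det (n : ℕ) (hn : 1 ≤ n)
    (H : Matrix (Fin n) (Fin n) ℝ)
    (hH : ∀ i j : Fin n, H i j = ((i : ℕ) + (j : ℕ)).factorial) :
    H.det = ∏ k ∈ Finset.range n, ((k.factorial : ℝ)) ^ 2 := by
  have h : H = factorialPascal n * (factorialPascal n).transpose := by
    ext i j
    rw [hH, factorialPascal_mul_transpose_apply]
  rw [h, Matrix.det_mul, Matrix.det_transpose, det_factorialPascal, Finset.prod_pow, sq]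
end

section
/- Fix n ≥ 1 and let M be the n×n matrix with entries M_{ij} = Γ(i + j − 3/2) for 1 ≤ i, j ≤ n (so M_{ij} = ∫_{-∞}^{∞} x^{2(i-1)} x^{2(j-1)} e^{-x²} dx). Then M is invertible and its inverse B has entries B_{ij} = ((-1)^{i+j} / Γ(1/2)) · (2^{2(i-1)} / (2(i−1))!) · (2^{2(j-1)} / (2(j−1))!) · Σ_{k=max(i,j)}^{n} ((2(k−1))! / 2^{2(k-1)}) · 1/((k−i)! (k−j)!). -/
/-- The numbers `(2k)! / 4 ^ k = k! * (1/2)_k`. -/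
noncomputable def scaledFactorial (k : ℕ) : ℝ := ((2 * k).factorial : ℝ) / 2 ^ (2 * k)

lemma scaledFactorial_pos (k : ℕ) : 0 < scaledFactorial k := by
  unfold scaledFactorial
  positivity

lemma scaledFactorial_succ (k : ℕ) :
    scaledFactorial (k + 1) = (k + 1) * (k + 1 / 2) * scaledFactorial k := by
  unfold scaledFactorial
  rw [show 2 * (k + 1) = 2 * k + 1 + 1 by ring, Nat.factorial_succ, Nat.factorial_succ]
  push_cast
  field_simp
  ring

lemma Gamma_natCast_add_half (m : ℕ) :
    Real.Gamma (m + 1 / 2) = Real.Gamma (1 / 2) * (scaledFactorial m / m.factorial) := by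
  induction m with
  | zero => simp [scaledFactorial]
  | succ m ih =>
    rw [show ((m + 1 : ℕ) : ℝ) + 1 / 2 = (m + 1 / 2 : ℝ) + 1 by push_cast; ring,
      Real.Gamma_add_one (by positivity), ih, scaledFactorial_succ, Nat.factorial_succ]
    push_cast
    field_simp

lemma ascPochhammer_eval_natCast_add_half (k m : ℕ) :
    (ascPochhammer ℝ m).eval ((k : ℝ) + 1 / 2) =
      scaledFactorial (k + m) * k.factorial / (scaledFactorial k * (k + m).factorial) := by
  have hk := (scaledFactorial_pos k).ne'
  induction m with
  | zero =>
    simp only [ascPochhammer_zero, Polynomial.eval_one, add_zero]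
    field_simp
  | succ m ih =>
    rw [ascPochhammer_succ_eval, ih, ← add_assoc, scaledFactorial_succ, Nat.factorial_succ]
    push_cast
    field_simp
    ring

lemma ring_choose_natCast_add_half (k m : ℕ) :
    Ring.choose ((k : ℝ) + m - 1 / 2) m =
      scaledFactorial (k + m) * k.factorial /
        (scaledFactorial k * (k + m).factorial * m.factorial) := by
  have h := Ring.factorial_nsmul_multichoose_eq_ascPochhammer ((k : ℝ) + 1 / 2) m
  rw [Polynomial.ascPochhammer_smeval_eq_eval, ascPochhammer_eval_natCast_add_half, nsmul_eq_mul] at h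
  have hk := (scaledFactorial_pos k).ne'
  rw [Ring.choose, show (k : ℝ) + m - 1 / 2 - m + 1 = k + 1 / 2 by ring]
  have hm : (m.factorial : ℝ) ≠ 0 := by positivity
  rw [← mul_right_inj' hm, h]
  field_simp

/-- The Chu–Vandermonde identity behind the `LDLᵀ` factorization of the Gram matrix. -/
lemma sum_inv_scaledFactorial (i j n : ℕ) (hi : i < n) :
    ∑ k ∈ Finset.range n, (if k ≤ i ∧ k ≤ j then
        1 / (scaledFactorial k * (i - k).factorial * (j - k).factorial) else 0) =
      scaledFactorial (i + j) / ((i + j).factorial * scaledFactorial i * scaledFactorial j) := by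
  have hai := (scaledFactorial_pos i).ne'
  have haj := (scaledFactorial_pos j).ne'
  have h := Ring.add_choose_eq i (Commute.all (j : ℝ) ((i : ℝ) - 1 / 2))
  rw [show (j : ℝ) + (i - 1 / 2) = j + i - 1 / 2 by ring, ring_choose_natCast_add_half,
    Finset.Nat.sum_antidiagonal_eq_sum_range_succ
      (fun a b => Ring.choose (j : ℝ) a * Ring.choose ((i : ℝ) - 1 / 2) b)] at h
  have hsub : Finset.range (i + 1) ⊆ Finset.range n := by
    intro x hx
    simp only [Finset.mem_range] at *
    omega
  rw [← Finset.sum_subset hsub (fun x _ hx => if_neg (by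
    simp only [Finset.mem_range] at hx
    omega))]
  have hc : scaledFactorial i * j.factorial / i.factorial ≠ 0 := by positivity
  rw [← mul_right_inj' hc]
  trans scaledFactorial (j + i) * j.factorial /
    (scaledFactorial j * (j + i).factorial * i.factorial)
  · rw [h, Finset.mul_sum]
    refine Finset.sum_congr rfl fun k hk => ?_
    have hki : k ≤ i := by
      simp only [Finset.mem_range] at hk
      omega
    have hak := (scaledFactorial_pos k).ne'
    by_cases hkj : k ≤ j
    · obtain ⟨m, rfl⟩ := Nat.exists_eq_add_of_le hki
      obtain ⟨l, rfl⟩ := Nat.exists_eq_add_of_le hkj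
      rw [if_pos ⟨hki, hkj⟩, Ring.choose_natCast, Nat.cast_choose ℝ hkj]
      simp only [Nat.add_sub_cancel_left]
      rw [show ((k + m : ℕ) : ℝ) - 1 / 2 = k + m - 1 / 2 by push_cast; ring,
        ring_choose_natCast_add_half]
      field_simp
    · rw [if_neg (by tauto), Ring.choose_natCast, Nat.choose_eq_zero_of_lt (by omega)]
      simp
  · rw [add_comm j i]
    field_simp

/-- The rescaled triangular matrix of coefficients of the even Hermite polynomials
(Laguerre polynomials of parameter `-1/2`); it is an involution. -/
noncomputable def evenHermiteCoeff (n : ℕ) : Matrix (Fin n) (Fin n) ℝ := fun i j =>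
  if (j : ℕ) ≤ i then
    (-1) ^ (j : ℕ) * scaledFactorial i / (scaledFactorial j * ((i : ℕ) - j).factorial)
  else 0

lemma sum_neg_one_pow_div_factorial (i k n : ℕ) (hi : i < n) :
    ∑ j ∈ Finset.range n, (if j ≤ i ∧ k ≤ j then
        (-1 : ℝ) ^ (j + k) / ((i - j).factorial * (j - k).factorial) else 0) =
      if i = k then 1 else 0 := by
  by_cases hki : k ≤ i
  · obtain ⟨m, rfl⟩ := Nat.exists_eq_add_of_le hki
    have hsub : Finset.Ico k (k + m + 1) ⊆ Finset.range n := by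
      intro x hx
      simp only [Finset.mem_Ico, Finset.mem_range] at *
      omega
    rw [← Finset.sum_subset hsub (fun x _ hx => if_neg (by
      simp only [Finset.mem_Ico] at hx
      omega)), Finset.sum_Ico_eq_sum_range, show k + m + 1 - k = m + 1 by omega]
    have h := congrArg (Int.cast : ℤ → ℝ) (Int.alternating_sum_range_choose (n := m))
    push_cast at h
    have hm : (m.factorial : ℝ) ≠ 0 := by positivity
    rw [← mul_right_inj' hm, Finset.mul_sum]
    trans ∑ j ∈ Finset.range (m + 1), (-1 : ℝ) ^ j * (m.choose j : ℝ)
    · refine Finset.sum_congr rfl fun j hj => ?_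
      have hjm : j ≤ m := by
        simp only [Finset.mem_range] at hj
        omega
      rw [if_pos (by omega), Nat.cast_choose ℝ hjm, show k + m - (k + j) = m - j by omega,
        show k + j - k = j by omega, show k + j + k = j + 2 * k by ring, pow_add, pow_mul]
      simp only [even_two, Even.neg_pow, one_pow, mul_one]
      field_simp
    · rw [h]
      by_cases h0 : m = 0 <;> simp [h0]
  · rw [if_neg (by omega)]
    exact Finset.sum_eq_zero fun j _ => if_neg (by omega)

lemma evenHermiteCoeff_mul_self (n : ℕ) : evenHermiteCoeff n * evenHermiteCoeff n = 1 := by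
  ext i k
  have h := sum_neg_one_pow_div_factorial i k n i.2
  rw [← Fin.sum_univ_eq_sum_range (fun j => if j ≤ (i : ℕ) ∧ (k : ℕ) ≤ j then
        (-1 : ℝ) ^ (j + k) / (((i : ℕ) - j).factorial * (j - (k : ℕ)).factorial) else 0)] at h
  have hi := (scaledFactorial_pos i).ne'
  have hk := (scaledFactorial_pos k).ne'
  trans scaledFactorial i / scaledFactorial k * (if (i : ℕ) = k then 1 else 0)
  · rw [← h, Matrix.mul_apply, Finset.mul_sum]
    refine Finset.sum_congr rfl fun j _ => ?_
    have hj := (scaledFactorial_pos j).ne'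
    unfold evenHermiteCoeff
    by_cases h1 : (j : ℕ) ≤ i
    · by_cases h2 : (k : ℕ) ≤ j
      · rw [if_pos h1, if_pos h2, if_pos ⟨h1, h2⟩, pow_add]
        field_simp
      · simp [h2]
    · simp [h1]
  · by_cases hik : i = k
    · subst hik
      simp [hi]
    · simp [hik, Fin.val_inj]

lemma evenHermite_gram_factorization (n : ℕ) (i j : Fin n) :
    (evenHermiteCoeff n *
        Matrix.diagonal (fun k : Fin n => Real.Gamma (1 / 2) * scaledFactorial k) *
        (evenHermiteCoeff n).transpose) i j =
      Real.Gamma (1 / 2) * (scaledFactorial (i + j) / ((i + j : ℕ).factorial : ℝ)) := by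
  have h := sum_inv_scaledFactorial i j n i.2
  rw [← Fin.sum_univ_eq_sum_range (fun k => if k ≤ (i : ℕ) ∧ k ≤ (j : ℕ) then
        1 / (scaledFactorial k * ((i : ℕ) - k).factorial * ((j : ℕ) - k).factorial) else 0)] at h
  have hi := (scaledFactorial_pos i).ne'
  have hj := (scaledFactorial_pos j).ne'
  trans Real.Gamma (1 / 2) * scaledFactorial i * scaledFactorial j *
    (scaledFactorial (i + j) / ((i + j : ℕ).factorial * scaledFactorial i * scaledFactorial j))
  · rw [← h, Matrix.mul_apply, Finset.mul_sum]
    refine Finset.sum_congr rfl fun k _ => ?_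
    have hk := (scaledFactorial_pos k).ne'
    rw [Matrix.mul_diagonal, Matrix.transpose_apply]
    unfold evenHermiteCoeff
    by_cases h1 : (k : ℕ) ≤ i
    · by_cases h2 : (k : ℕ) ≤ j
      · have hs : ((-1 : ℝ) ^ (k : ℕ)) ^ 2 = 1 := by rw [← pow_mul, mul_comm, pow_mul]; simp
        rw [if_pos h1, if_pos h2, if_pos ⟨h1, h2⟩]
        field_simp
        rw [hs]
      · simp [h2]
    · simp [h1]
  · field_simp

lemma evenHermite_inverse_factorization (n : ℕ) (i j : Fin n) :
    ((evenHermiteCoeff n).transpose *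
        Matrix.diagonal (fun k : Fin n => (Real.Gamma (1 / 2) * scaledFactorial k)⁻¹) *
        evenHermiteCoeff n) i j =
      (-1 : ℝ) ^ (((i : ℕ) + 1) + ((j : ℕ) + 1)) / Real.Gamma (1 / 2) *
        (scaledFactorial i)⁻¹ * (scaledFactorial j)⁻¹ *
        ∑ k ∈ Finset.univ.filter (fun k : Fin n => max i j ≤ k),
          scaledFactorial k *
            (1 / ((((k : ℕ) - (i : ℕ)).factorial : ℝ) *
              (((k : ℕ) - (j : ℕ)).factorial : ℝ))) := by
  have hi := (scaledFactorial_pos i).ne'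
  have hj := (scaledFactorial_pos j).ne'
  have hG : Real.Gamma (1 / 2) ≠ 0 := (Real.Gamma_pos_of_pos (by norm_num)).ne'
  rw [Matrix.mul_apply, Finset.sum_filter, Finset.mul_sum]
  refine Finset.sum_congr rfl fun k _ => ?_
  have hk := (scaledFactorial_pos k).ne'
  rw [Matrix.mul_diagonal, Matrix.transpose_apply]
  unfold evenHermiteCoeff
  by_cases h1 : (i : ℕ) ≤ k
  · by_cases h2 : (j : ℕ) ≤ k
    · rw [if_pos h1, if_pos h2, if_pos (max_le (Fin.le_def.2 h1) (Fin.le_def.2 h2) : max i j ≤ k),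
        show ((i : ℕ) + 1) + ((j : ℕ) + 1) = i + j + 2 by ring, pow_add, pow_add]
      generalize Real.Gamma (1 / 2) = G at *
      field_simp
    · rw [if_neg h2, if_neg fun h : max i j ≤ k => h2 (Fin.le_def.1 (le_of_max_le_right h))]
      simp
  · rw [if_neg h1, if_neg fun h : max i j ≤ k => h1 (Fin.le_def.1 (le_of_max_le_left h))]
    simp

/-- The inverse of the Gram matrix `M i j = Γ(i + j − 3/2)` (indices running from `1` to
`n`) of the even monomials `1, x², …, x^{2(n-1)}` with weight `e^{-x²}` on `ℝ`. -/
theorem evenHermite_gram_inverse (n : ℕ) (hn : 1 ≤ n)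
    (M : Matrix (Fin n) (Fin n) ℝ)
    (hM : ∀ i j : Fin n,
      M i j = Real.Gamma (((i : ℕ) + 1 : ℝ) + ((j : ℕ) + 1 : ℝ) - 3 / 2)) :
    IsUnit M ∧
      ∀ i j : Fin n,
        M⁻¹ i j =
          (-1 : ℝ) ^ (((i : ℕ) + 1) + ((j : ℕ) + 1)) / Real.Gamma (1 / 2) *
            ((2 : ℝ) ^ (2 * (i : ℕ)) / ((2 * (i : ℕ)).factorial : ℝ)) *
            ((2 : ℝ) ^ (2 * (j : ℕ)) / ((2 * (j : ℕ)).factorial : ℝ)) *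
            ∑ k ∈ Finset.univ.filter (fun k : Fin n => max i j ≤ k),
              (((2 * (k : ℕ)).factorial : ℝ) / (2 : ℝ) ^ (2 * (k : ℕ))) *
                (1 / ((((k : ℕ) - (i : ℕ)).factorial : ℝ) *
                  (((k : ℕ) - (j : ℕ)).factorial : ℝ))) := by
  have hG : Real.Gamma (1 / 2) ≠ 0 := (Real.Gamma_pos_of_pos (by norm_num)).ne'
  set P := evenHermiteCoeff n
  set E := Matrix.diagonal (fun k : Fin n => Real.Gamma (1 / 2) * scaledFactorial k) with hE
  set D := Matrix.diagonal (fun k : Fin n => (Real.Gamma (1 / 2) * scaledFactorial k)⁻¹) with hD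
  have hPP : P * P = 1 := evenHermiteCoeff_mul_self n
  have hPt : P.transpose * P.transpose = 1 := by
    rw [← Matrix.transpose_mul, hPP, Matrix.transpose_one]
  have hED : E * D = 1 := by
    rw [hE, hD, Matrix.diagonal_mul_diagonal, ← Matrix.diagonal_one]
    congr 1
    funext k
    exact mul_inv_cancel₀ (mul_ne_zero hG (scaledFactorial_pos k).ne')
  have hMf : M = P * E * P.transpose := by
    ext i j
    rw [hM, evenHermite_gram_factorization, ← Gamma_natCast_add_half]
    congr 1
    push_cast
    ring
  have hMB : M * (P.transpose * D * P) = 1 := by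
    calc M * (P.transpose * D * P)
        = P * E * (P.transpose * P.transpose) * D * P := by rw [hMf]; simp only [Matrix.mul_assoc]
      _ = P * (E * D) * P := by rw [hPt]; simp only [Matrix.mul_assoc, Matrix.one_mul]
      _ = 1 := by rw [hED, Matrix.mul_one, hPP]
  refine ⟨IsUnit.of_mul_eq_one _ hMB, fun i j => ?_⟩
  rw [Matrix.inv_eq_right_inv hMB, evenHermite_inverse_factorization]
  simp only [scaledFactorial, inv_div]
end

section
/- Fix n ≥ 1 and let M be the n×n matrix with entries M_{ij} = Γ(i + j − 1/2) for 1 ≤ i, j ≤ n (so M_{ij} = ∫_{-∞}^{∞} x^{2(i-1)+1} x^{2(j-1)+1} e^{-x²} dx). Then M is invertible and its inverse B has entries B_{ij} = ((-1)^{i+j} / Γ(1/2)) · (2^{2(i-1)+1} / (2(i−1)+1)!) · (2^{2(j-1)+1} / (2(j−1)+1)!) · Σ_{k=max(i,j)}^{n} ((2(k−1)+1)! / 2^{2(k-1)+1}) · 1/((k−i)! (k−j)!). -/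
open Finset in
lemma sum_alternating_choose_succ_mul (f : ℕ → ℝ) (k : ℕ) :
    ∑ j ∈ range (k + 2), (-1 : ℝ) ^ j * ((k + 1).choose j : ℝ) * f j =
      ∑ j ∈ range (k + 1), (-1 : ℝ) ^ j * (k.choose j : ℝ) * (f j - f (j + 1)) := by
  have h : ∑ j ∈ range (k + 1), (-1 : ℝ) ^ j * (k.choose j : ℝ) * f j =
      ∑ j ∈ range (k + 1), (-1 : ℝ) ^ (j + 1) * (k.choose (j + 1) : ℝ) * f (j + 1) + f 0 := by
    have h' := sum_range_succ (fun j => (-1 : ℝ) ^ j * (k.choose j : ℝ) * f j) (k + 1)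
    rw [sum_range_succ'] at h'
    simpa using h'.symm
  simp only [mul_sub, sum_sub_distrib]
  rw [sum_range_succ', h, add_sub_right_comm, ← sum_sub_distrib]
  congr 1
  · refine sum_congr rfl fun j _ => ?_
    rw [Nat.choose_succ_succ]
    push_cast
    ring
  · simp

open Finset in
lemma sum_alternating_choose_mul_choose (l i : ℕ) :
    ∑ k ∈ range (l + 1), (-1 : ℝ) ^ k * (l.choose k : ℝ) * (k.choose i : ℝ) =
      if i = l then (-1 : ℝ) ^ l else 0 := by
  induction l generalizing i with
  | zero => cases i <;> simp
  | succ l ih =>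
    rw [sum_alternating_choose_succ_mul (fun k => (k.choose i : ℝ))]
    cases i with
    | zero => simp
    | succ i =>
      have h : ∀ k : ℕ, (k.choose (i + 1) : ℝ) - ((k + 1).choose (i + 1) : ℝ) =
          -(k.choose i : ℝ) := fun k => by
        rw [Nat.choose_succ_succ]
        push_cast
        ring
      simp only [h, mul_neg, sum_neg_distrib, ih]
      by_cases hil : i = l <;> simp [hil, pow_succ]

open Finset in
/-- The `k`-th finite difference of the rising factorial `Γ(x + l) / Γ(x)`. -/
lemma sum_alternating_choose_mul_Gamma_ratio (k l : ℕ) {x : ℝ} (hx : 0 < x) :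
    ∑ j ∈ range (k + 1), (-1 : ℝ) ^ j * (k.choose j : ℝ) *
        (Real.Gamma (x + j + l) / Real.Gamma (x + j)) =
      (-1 : ℝ) ^ k * (l.descFactorial k : ℝ) * (Real.Gamma (x + l) / Real.Gamma (x + k)) := by
  induction k generalizing x with
  | zero => simp
  | succ k ih =>
    have hshift := ih (x := x + 1) (by positivity)
    rw [sum_alternating_choose_succ_mul
      (fun j => Real.Gamma (x + j + l) / Real.Gamma (x + j))]
    simp only [mul_sub, sum_sub_distrib]
    rw [ih hx]
    have h : ∀ j : ℕ, x + ((j + 1 : ℕ) : ℝ) = x + 1 + j := fun j => by push_cast; ring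
    simp only [h]
    rw [hshift, show x + 1 + (l : ℝ) = x + l + 1 by ring,
      show x + 1 + (k : ℝ) = x + k + 1 by ring,
      Real.Gamma_add_one (by positivity), Real.Gamma_add_one (by positivity)]
    have hG : Real.Gamma (x + k) ≠ 0 := (Real.Gamma_pos_of_pos (by positivity)).ne'
    have hxk : x + k ≠ 0 := by positivity
    have hd : (l.descFactorial (k + 1) : ℝ) = ((l : ℝ) - k) * l.descFactorial k := by
      rw [Nat.descFactorial_succ]
      rcases le_or_gt k l with hkl | hkl
      · push_cast [Nat.cast_sub hkl]
        ring
      · simp [Nat.descFactorial_of_lt hkl]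
    rw [hd]
    field_simp
    ring

lemma factorial_two_mul_add_one_div_two_pow (k : ℕ) :
    ((2 * k + 1).factorial : ℝ) / (2 : ℝ) ^ (2 * k + 1) =
      k.factorial * Real.Gamma (3 / 2 + k) / Real.Gamma (1 / 2) := by
  have hG : Real.Gamma (1 / 2) ≠ 0 := (Real.Gamma_pos_of_pos (by norm_num)).ne'
  induction k with
  | zero =>
    rw [show (3 / 2 + ((0 : ℕ) : ℝ)) = 1 / 2 + 1 by norm_num, Real.Gamma_add_one (by norm_num)]
    simp
    field_simp
  | succ k ih =>
    rw [show (3 / 2 + ((k + 1 : ℕ) : ℝ)) = 3 / 2 + k + 1 by push_cast; ring,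
      Real.Gamma_add_one (by positivity), show 2 * (k + 1) + 1 = 2 * k + 1 + 1 + 1 by ring,
      Nat.factorial_succ (2 * k + 1 + 1), Nat.factorial_succ (2 * k + 1), Nat.factorial_succ k]
    calc _ = (((2 * k + 1).factorial : ℝ) / (2 : ℝ) ^ (2 * k + 1)) *
          ((k + 1) * (3 / 2 + k)) := by
          push_cast
          field_simp
          ring
      _ = _ := by
          rw [ih]
          push_cast
          ring

lemma ite_one_div_factorial_sub (k i : ℕ) :
    (if i ≤ k then 1 / ((k - i).factorial : ℝ) else 0) =
      k.choose i * i.factorial / k.factorial := by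
  split_ifs with h
  · rw [Nat.cast_choose ℝ h]
    have := Nat.factorial_ne_zero k
    have := Nat.factorial_ne_zero i
    field_simp
  · simp [Nat.choose_eq_zero_of_lt (not_le.mp h)]

lemma oddHermite_inverse_entry_eq {n : ℕ} (i j : Fin n) :
    (-1 : ℝ) ^ (((i : ℕ) + 1) + ((j : ℕ) + 1)) / Real.Gamma (1 / 2) *
            ((2 : ℝ) ^ (2 * (i : ℕ) + 1) / ((2 * (i : ℕ) + 1).factorial : ℝ)) *
            ((2 : ℝ) ^ (2 * (j : ℕ) + 1) / ((2 * (j : ℕ) + 1).factorial : ℝ)) *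
            ∑ k ∈ Finset.univ.filter (fun k : Fin n => max i j ≤ k),
              (((2 * (k : ℕ) + 1).factorial : ℝ) / (2 : ℝ) ^ (2 * (k : ℕ) + 1)) *
                (1 / ((((k : ℕ) - (i : ℕ)).factorial : ℝ) *
                  (((k : ℕ) - (j : ℕ)).factorial : ℝ))) =
      ∑ k : Fin n, (-1 : ℝ) ^ (i : ℕ) * Real.Gamma (3 / 2 + (k : ℕ)) /
        ((k : ℕ).factorial * Real.Gamma (3 / 2 + (i : ℕ))) * ((k : ℕ).choose i : ℝ) *
          ((-1 : ℝ) ^ (j : ℕ) * ((k : ℕ).choose j : ℝ) / Real.Gamma (3 / 2 + (j : ℕ))) := by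
  rw [Finset.sum_filter, Finset.mul_sum]
  refine Finset.sum_congr rfl fun k _ => ?_
  have hG : Real.Gamma (1 / 2) ≠ 0 := (Real.Gamma_pos_of_pos (by norm_num)).ne'
  have hpos : ∀ m : ℕ, Real.Gamma (3 / 2 + m) ≠ 0 := fun m =>
    (Real.Gamma_pos_of_pos (by positivity)).ne'
  have hi := hpos i
  have hj := hpos j
  have hinv : ∀ m : ℕ, (2 : ℝ) ^ (2 * m + 1) / ((2 * m + 1).factorial : ℝ) =
      Real.Gamma (1 / 2) / (m.factorial * Real.Gamma (3 / 2 + m)) := fun m => by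
    rw [← inv_div, factorial_two_mul_add_one_div_two_pow, inv_div]
  have hite : (if max i j ≤ k then (((2 * (k : ℕ) + 1).factorial : ℝ) / (2 : ℝ) ^ (2 * (k : ℕ) + 1)) *
                (1 / ((((k : ℕ) - (i : ℕ)).factorial : ℝ) *
                  (((k : ℕ) - (j : ℕ)).factorial : ℝ))) else 0) =
      (((2 * (k : ℕ) + 1).factorial : ℝ) / (2 : ℝ) ^ (2 * (k : ℕ) + 1)) *
        ((if (i : ℕ) ≤ k then 1 / (((k : ℕ) - i).factorial : ℝ) else 0) *
          (if (j : ℕ) ≤ k then 1 / (((k : ℕ) - j).factorial : ℝ) else 0)) := by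
    by_cases h1 : i ≤ k <;> by_cases h2 : j ≤ k <;>
      simp [h1, h2, mul_comm]
  rw [hite, ite_one_div_factorial_sub, ite_one_div_factorial_sub, hinv, hinv,
    factorial_two_mul_add_one_div_two_pow]
  have hk := Nat.factorial_ne_zero k
  have hfi := Nat.factorial_ne_zero i
  have hfj := Nat.factorial_ne_zero j
  rw [show (i : ℕ) + 1 + (j + 1) = i + j + 2 by ring, pow_add _ _ 2, pow_add]
  field_simp

lemma sum_fin_eq_sum_range_of_eq_zero {n l : ℕ} (hl : l < n) (f : ℕ → ℝ)
    (hf : ∀ k, l < k → f k = 0) : ∑ k : Fin n, f k = ∑ k ∈ Finset.range (l + 1), f k := by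
  rw [Fin.sum_univ_eq_sum_range]
  refine (Finset.sum_subset (Finset.range_mono hl) fun k _ hk => hf k ?_).symm
  simpa using hk

/-- The inverse of the Gram matrix `M i j = Γ(i + j − 1/2)` (indices running from `1` to
`n`) of the odd monomials `x, x³, …, x^{2(n-1)+1}` with weight `e^{-x²}` on `ℝ`. -/
theorem oddHermite_gram_inverse (n : ℕ) (hn : 1 ≤ n)
    (M : Matrix (Fin n) (Fin n) ℝ)
    (hM : ∀ i j : Fin n,
      M i j = Real.Gamma (((i : ℕ) + 1 : ℝ) + ((j : ℕ) + 1 : ℝ) - 1 / 2)) :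
    IsUnit M ∧
      ∀ i j : Fin n,
        M⁻¹ i j =
          (-1 : ℝ) ^ (((i : ℕ) + 1) + ((j : ℕ) + 1)) / Real.Gamma (1 / 2) *
            ((2 : ℝ) ^ (2 * (i : ℕ) + 1) / ((2 * (i : ℕ) + 1).factorial : ℝ)) *
            ((2 : ℝ) ^ (2 * (j : ℕ) + 1) / ((2 * (j : ℕ) + 1).factorial : ℝ)) *
            ∑ k ∈ Finset.univ.filter (fun k : Fin n => max i j ≤ k),
              (((2 * (k : ℕ) + 1).factorial : ℝ) / (2 : ℝ) ^ (2 * (k : ℕ) + 1)) *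
                (1 / ((((k : ℕ) - (i : ℕ)).factorial : ℝ) *
                  (((k : ℕ) - (j : ℕ)).factorial : ℝ))) := by
  let B : Matrix (Fin n) (Fin n) ℝ := Matrix.of fun i j =>
    ∑ k : Fin n, (-1 : ℝ) ^ (i : ℕ) * Real.Gamma (3 / 2 + (k : ℕ)) /
      ((k : ℕ).factorial * Real.Gamma (3 / 2 + (i : ℕ))) * ((k : ℕ).choose i : ℝ) *
        ((-1 : ℝ) ^ (j : ℕ) * ((k : ℕ).choose j : ℝ) / Real.Gamma (3 / 2 + (j : ℕ)))
  have hpos : ∀ m : ℕ, Real.Gamma (3 / 2 + m) ≠ 0 := fun m =>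
    (Real.Gamma_pos_of_pos (by positivity)).ne'
  have hinner : ∀ k l : Fin n, ∑ j : Fin n,
      (-1 : ℝ) ^ (j : ℕ) * ((k : ℕ).choose j : ℝ) / Real.Gamma (3 / 2 + (j : ℕ)) * M j l =
        (-1 : ℝ) ^ (k : ℕ) * ((l : ℕ).descFactorial k : ℝ) *
          (Real.Gamma (3 / 2 + (l : ℕ)) / Real.Gamma (3 / 2 + (k : ℕ))) := fun k l => by
    rw [← sum_alternating_choose_mul_Gamma_ratio k l (by norm_num : (0 : ℝ) < 3 / 2),
      ← sum_fin_eq_sum_range_of_eq_zero k.isLt _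
        fun j hj => by simp [Nat.choose_eq_zero_of_lt hj]]
    refine Finset.sum_congr rfl fun j _ => ?_
    rw [hM, show ((j : ℕ) + 1 : ℝ) + ((l : ℕ) + 1 : ℝ) - 1 / 2 = 3 / 2 + (j : ℕ) + (l : ℕ) by ring]
    ring
  have hBM : B * M = 1 := by
    ext i l
    have hsum : (B * M) i l = (-1 : ℝ) ^ (i : ℕ) * Real.Gamma (3 / 2 + (l : ℕ)) /
        Real.Gamma (3 / 2 + (i : ℕ)) *
          ∑ k : Fin n, (-1 : ℝ) ^ (k : ℕ) * ((l : ℕ).choose k : ℝ) * ((k : ℕ).choose i : ℝ) := by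
      simp only [Matrix.mul_apply, B, Matrix.of_apply, Finset.sum_mul]
      rw [Finset.sum_comm, Finset.mul_sum]
      refine Finset.sum_congr rfl fun k _ => ?_
      simp only [mul_assoc _ (_ / Real.Gamma _) (M _ _)]
      rw [← Finset.mul_sum, hinner, Nat.descFactorial_eq_factorial_mul_choose]
      have hi := hpos i
      have hk := hpos k
      have hfk := Nat.factorial_ne_zero k
      push_cast
      field_simp
    rw [hsum, sum_fin_eq_sum_range_of_eq_zero l.isLt
        (fun k => (-1 : ℝ) ^ k * ((l : ℕ).choose k : ℝ) * (k.choose i : ℝ))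
        fun k hk => by simp [Nat.choose_eq_zero_of_lt hk],
      sum_alternating_choose_mul_choose, Matrix.one_apply]
    by_cases hil : i = l
    · subst hil
      have hi := hpos i
      simp only [if_true]
      field_simp
      rw [← pow_mul, mul_comm, pow_mul]
      simp
    · simp [hil, Fin.val_inj]
  refine ⟨IsUnit.of_mul_eq_one_right B hBM, fun i j => ?_⟩
  rw [Matrix.inv_eq_left_inv hBM, oddHermite_inverse_entry_eq]
  rfl
end

section
/- Fix n ≥ 1 and let B be the n×n matrix with entries B_{ij} = ((-1)^{i+j} / ((i−1)! (j−1)!)) · Σ_{k=max(i,j)}^{n} binom(k−1, i−1) binom(k−1, j−1). Then for every real polynomial p of degree at most n − 1 and every x ∈ ℝ, ∫₀^∞ (Σ_{i=1}^{n} Σ_{j=1}^{n} B_{ij} x^{i-1} y^{j-1}) p(y) e^{-y} dy = p(x). -/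
open Finset in
/-- An alternating binomial sum computed as an iterated forward difference. -/
theorem alternating_sum_choose_mul_add_choose {n k : ℕ} (hk : k < n) (m : ℕ) :
    ∑ j ∈ range n, (-1 : ℝ) ^ j * (k.choose j : ℝ) * ((j + m).choose m : ℝ) =
      (-1) ^ k * (m.choose k : ℝ) := by
  have key : ∑ j ∈ range (k + 1),
      ((-1 : ℤ) ^ (k - j) * (k.choose j : ℤ)) * ((m + j).choose m : ℤ) = (m.choose k : ℤ) := by
    have h := fwdDiff_iter_eq_sum_shift (1 : ℕ) (fun x : ℕ ↦ (x.choose m : ℤ)) k m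
    simp only [smul_eq_mul, mul_one] at h
    rw [← h]
    rcases le_or_gt k m with hkm | hkm
    · obtain ⟨d, rfl⟩ := Nat.exists_eq_add_of_le hkm
      rw [fwdDiff_iter_choose]
      simpa using Nat.choose_symm_add.symm
    · obtain ⟨d, rfl⟩ := Nat.exists_eq_add_of_lt hkm
      have h0 := fwdDiff_iter_choose 0 m
      rw [add_zero] at h0
      rw [show m + d + 1 = (d + 1) + m by ring, Function.iterate_add_apply, h0,
        Nat.choose_eq_zero_of_lt (by omega), Function.iterate_succ_apply]
      simp [fwdDiff_iter_eq_sum_shift]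
  have keyR : ∑ j ∈ range (k + 1),
      ((-1 : ℝ) ^ (k - j) * (k.choose j : ℝ)) * ((m + j).choose m : ℝ) = (m.choose k : ℝ) := by
    exact_mod_cast congrArg (Int.cast : ℤ → ℝ) key
  rw [← keyR, mul_sum]
  refine (sum_subset (range_subset_range.2 hk) fun j _ hj ↦ ?_).symm.trans
    (sum_congr rfl fun j hj ↦ ?_)
  · rw [mem_range, not_lt] at hj
    simp [Nat.choose_eq_zero_of_lt hj]
  · obtain ⟨d, rfl⟩ := Nat.exists_eq_add_of_le (mem_range_succ_iff.1 hj)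
    have hd : (-1 : ℝ) ^ d * (-1) ^ d = 1 := by rw [← mul_pow]; norm_num
    rw [add_tsub_cancel_left, pow_add, add_comm m j]
    linear_combination -((-1 : ℝ) ^ j * ((j + d).choose j : ℝ) * ((j + m).choose m : ℝ)) * hd

open Finset in
/-- Orthogonality of the signed binomial coefficients. -/
theorem alternating_sum_choose_mul_choose {n m : ℕ} (hm : m < n) (i : ℕ) :
    ∑ k ∈ range n, (-1 : ℝ) ^ (i + k) * (m.choose k : ℝ) * (k.choose i : ℝ) =
      if m = i then 1 else 0 := by
  have h := fwdDiff_iter_choose_zero i m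
  rw [fwdDiff_iter_eq_sum_shift] at h
  simp only [smul_eq_mul, mul_one, zero_add] at h
  have hR : ∑ k ∈ range (m + 1),
      ((-1 : ℝ) ^ (m - k) * (m.choose k : ℝ)) * (k.choose i : ℝ) = if m = i then 1 else 0 := by
    exact_mod_cast congrArg (Int.cast : ℤ → ℝ) h
  have hs : (if m = i then (1 : ℝ) else 0) = (-1) ^ (i + m) * if m = i then 1 else 0 := by
    split_ifs with hmi
    · rw [hmi, pow_add, ← mul_pow]; norm_num
    · simp
  rw [hs, ← hR, mul_sum]
  refine (sum_subset (range_subset_range.2 hm) fun k _ hk ↦ ?_).symm.trans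
    (sum_congr rfl fun k hk ↦ ?_)
  · rw [mem_range, not_lt] at hk
    simp [Nat.choose_eq_zero_of_lt hk]
  · obtain ⟨d, rfl⟩ := Nat.exists_eq_add_of_le (mem_range_succ_iff.1 hk)
    have hd : (-1 : ℝ) ^ d * (-1) ^ d = 1 := by rw [← mul_pow]; norm_num
    rw [add_tsub_cancel_left, pow_add, pow_add, pow_add]
    linear_combination -((-1 : ℝ) ^ i * (-1) ^ k * ((k + d).choose k : ℝ) * (k.choose i : ℝ)) * hd

open Finset in
/-- The explicit matrix is a left inverse of the Hankel matrix of factorials. -/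
theorem sum_explicitInverse_mul_factorial {n m : ℕ} (hm : m < n) (i : ℕ) :
    ∑ j ∈ range n, ((-1 : ℝ) ^ (i + j) / ((i.factorial : ℝ) * (j.factorial : ℝ)) *
      ∑ k ∈ range n, ((k.choose i : ℝ) * (k.choose j : ℝ))) * ((j + m).factorial : ℝ) =
      if m = i then 1 else 0 := by
  have hf (j : ℕ) : (j.factorial : ℝ) ≠ 0 := by positivity
  have hterm (j k : ℕ) : (-1 : ℝ) ^ (i + j) / ((i.factorial : ℝ) * (j.factorial : ℝ)) *
      ((k.choose i : ℝ) * (k.choose j : ℝ)) * ((j + m).factorial : ℝ) =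
      (m.factorial : ℝ) / i.factorial * (-1) ^ i * (k.choose i : ℝ) *
        ((-1) ^ j * (k.choose j : ℝ) * ((j + m).choose m : ℝ)) := by
    have h : ((j + m).factorial : ℝ) = (j + m).choose m * j.factorial * m.factorial := by
      exact_mod_cast (Nat.add_choose_mul_factorial_mul_factorial j m).symm
    rw [h, pow_add]
    field_simp [hf i, hf j]
  simp only [mul_sum, sum_mul, hterm]
  rw [sum_comm]
  calc _ = ∑ k ∈ range n, (m.factorial : ℝ) / i.factorial *
        ((-1) ^ (i + k) * (m.choose k : ℝ) * (k.choose i : ℝ)) := by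
        refine sum_congr rfl fun k hk ↦ ?_
        rw [← mul_sum, alternating_sum_choose_mul_add_choose (mem_range.1 hk), pow_add]
        ring
    _ = _ := by
        rw [← mul_sum, alternating_sum_choose_mul_choose hm]
        split_ifs with h
        · rw [h, mul_one, div_self (hf i)]
        · rw [mul_zero]

open MeasureTheory in
/-- The moments of the weight `exp (-y)` on the positive half-line are integrable. -/
theorem integrableOn_pow_mul_exp_neg (a : ℕ) :
    IntegrableOn (fun y : ℝ ↦ y ^ a * Real.exp (-y)) (Set.Ioi 0) := by
  have h := Real.GammaIntegral_convergent (s := a + 1) (by positivity)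
  simpa [mul_comm] using h

/-- The moments of the weight `exp (-y)` on the positive half-line are the factorials. -/
theorem integral_pow_mul_exp_neg (a : ℕ) :
    ∫ y in Set.Ioi (0 : ℝ), y ^ a * Real.exp (-y) = (a.factorial : ℝ) := by
  rw [← Real.Gamma_nat_eq_factorial, Real.Gamma_eq_integral (by positivity)]
  simp [mul_comm]


/-- The explicit inverse `B` of the Hankel Gram matrix `H i j = (i+j−2)!` gives a
reproducing kernel `K(x,y) = ∑ i j, B i j ⬝ x^{i-1} y^{j-1}` for polynomials of degree at
most `n − 1` on `(0, ∞)` with weight `e^{-y}`. -/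
theorem laguerre_reproducing_kernel (n : ℕ) (hn : 1 ≤ n)
    (B : Matrix (Fin n) (Fin n) ℝ)
    (hB : ∀ i j : Fin n,
      B i j =
        (-1 : ℝ) ^ ((i : ℕ) + (j : ℕ)) /
            (((i : ℕ).factorial : ℝ) * ((j : ℕ).factorial : ℝ)) *
          ∑ k ∈ Finset.univ.filter (fun k : Fin n => max i j ≤ k),
            (((k : ℕ).choose (i : ℕ) : ℝ) * ((k : ℕ).choose (j : ℕ) : ℝ))) :
    ∀ p : Polynomial ℝ, p.natDegree ≤ n - 1 → ∀ x : ℝ,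
      ∫ y in Set.Ioi (0 : ℝ),
        (∑ i : Fin n, ∑ j : Fin n, B i j * x ^ (i : ℕ) * y ^ (j : ℕ)) *
          p.eval y * Real.exp (-y) = p.eval x := by
  intro p hp x
  have hB' (i j : Fin n) : B i j = (-1 : ℝ) ^ ((i : ℕ) + (j : ℕ)) /
      (((i : ℕ).factorial : ℝ) * ((j : ℕ).factorial : ℝ)) *
        ∑ k ∈ Finset.range n, ((k.choose (i : ℕ) : ℝ) * (k.choose (j : ℕ) : ℝ)) := by
    rw [hB, Finset.sum_range, Finset.sum_filter_of_ne]
    intro k _ hk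
    rw [max_le_iff]
    constructor <;> by_contra! h <;> apply hk
    · rw [Nat.choose_eq_zero_of_lt (show (k : ℕ) < i from h), Nat.cast_zero, zero_mul]
    · rw [Nat.choose_eq_zero_of_lt (show (k : ℕ) < j from h), Nat.cast_zero, mul_zero]
  have hinv (i m : Fin n) :
      ∑ j : Fin n, B i j * (((j : ℕ) + (m : ℕ)).factorial : ℝ) = if m = i then 1 else 0 := by
    simp_rw [Fin.ext_iff, ← sum_explicitInverse_mul_factorial m.isLt, hB', Finset.sum_range]
  have heval (y : ℝ) : p.eval y = ∑ m : Fin n, p.coeff m * y ^ (m : ℕ) := by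
    rw [Polynomial.eval_eq_sum_range' (by omega : p.natDegree < n), Finset.sum_range]
  calc _ = ∫ y in Set.Ioi (0 : ℝ), ∑ i : Fin n, ∑ m : Fin n, ∑ j : Fin n,
        p.coeff m * x ^ (i : ℕ) * B i j * (y ^ ((j : ℕ) + (m : ℕ)) * Real.exp (-y)) := by
        congr with y
        rw [heval, mul_assoc, Finset.sum_mul]
        refine Finset.sum_congr rfl fun i _ ↦ ?_
        simp only [Finset.sum_mul, Finset.mul_sum]
        refine Finset.sum_congr rfl fun m _ ↦ Finset.sum_congr rfl fun j _ ↦ ?_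
        ring
    _ = ∑ i : Fin n, ∑ m : Fin n, ∑ j : Fin n,
        p.coeff m * x ^ (i : ℕ) * B i j * (((j : ℕ) + (m : ℕ)).factorial : ℝ) := by
        have hint (i m j : Fin n) := (integrableOn_pow_mul_exp_neg ((j : ℕ) + (m : ℕ))).const_mul
          (p.coeff m * x ^ (i : ℕ) * B i j)
        rw [MeasureTheory.integral_finsetSum _ fun i _ ↦ MeasureTheory.integrable_finsetSum _
          fun m _ ↦ MeasureTheory.integrable_finsetSum _ fun j _ ↦ hint i m j]
        refine Finset.sum_congr rfl fun i _ ↦ ?_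
        rw [MeasureTheory.integral_finsetSum _ fun m _ ↦ MeasureTheory.integrable_finsetSum _
          fun j _ ↦ hint i m j]
        refine Finset.sum_congr rfl fun m _ ↦ ?_
        rw [MeasureTheory.integral_finsetSum _ fun j _ ↦ hint i m j]
        refine Finset.sum_congr rfl fun j _ ↦ ?_
        rw [MeasureTheory.integral_const_mul, integral_pow_mul_exp_neg]
    _ = p.eval x := by
        simp_rw [mul_assoc, ← Finset.mul_sum, hinv, heval]
        simp
end

section
/- For every n ≥ 1, the infimum over all real polynomials p of degree at most n − 1 of ∫₀^∞ (e^{-x} − p(x))² e^{-x} dx equals 1/(3 · 4ⁿ), i.e. the squared L²((0,∞), e^{-x}dx) distance from the function e^{-x} to the space of polynomials of degree less than n is 4^{-n}/3. -/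
open MeasureTheory Polynomial Finset

theorem integral_pow_mul_exp_neg_mul_Ioi {c : ℝ} (hc : 0 < c) (k : ℕ) :
    ∫ x in Set.Ioi (0 : ℝ), x ^ k * Real.exp (-(c * x)) = k.factorial / c ^ (k + 1) := by
  have h := Real.integral_rpow_mul_exp_neg_mul_Ioi (a := (k : ℝ) + 1) (by positivity) hc
  rw [Real.Gamma_nat_eq_factorial] at h
  simp only [add_sub_cancel_right, Real.rpow_natCast] at h
  rw [h, ← Nat.cast_add_one, Real.rpow_natCast, one_div, inv_pow]
  field_simp

theorem integrableOn_pow_mul_exp_neg_mul_Ioi {c : ℝ} (hc : 0 < c) (k : ℕ) :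
    IntegrableOn (fun x : ℝ => x ^ k * Real.exp (-(c * x))) (Set.Ioi 0) := by
  apply Integrable.of_integral_ne_zero
  rw [integral_pow_mul_exp_neg_mul_Ioi hc]
  positivity

/-- The functional `p ↦ ∫₀^∞ p(x) e^{-cx} dx` on polynomials (for `0 < c`), in terms of the
coefficients of `p`. -/
noncomputable def polyLaplace (c : ℝ) : ℝ[X] →ₗ[ℝ] ℝ :=
  Polynomial.lsum fun k => ((k.factorial : ℝ) / c ^ (k + 1)) • LinearMap.id

theorem polyLaplace_monomial (c : ℝ) (k : ℕ) (a : ℝ) :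
    polyLaplace c (monomial k a) = k.factorial / c ^ (k + 1) * a := by
  simp [polyLaplace, Polynomial.lsum_apply, Polynomial.sum_monomial_index]

theorem integrableOn_eval_mul_exp_neg_mul_Ioi {c : ℝ} (hc : 0 < c) (p : ℝ[X]) :
    IntegrableOn (fun x : ℝ => p.eval x * Real.exp (-(c * x))) (Set.Ioi 0) := by
  induction p using Polynomial.induction_on' with
  | add p q hp hq =>
    simp only [eval_add, add_mul]
    exact Integrable.add hp hq
  | monomial k a =>
    simp only [eval_monomial, mul_assoc]
    exact (integrableOn_pow_mul_exp_neg_mul_Ioi hc k).const_mul a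

theorem integral_eval_mul_exp_neg_mul_Ioi {c : ℝ} (hc : 0 < c) (p : ℝ[X]) :
    ∫ x in Set.Ioi (0 : ℝ), p.eval x * Real.exp (-(c * x)) = polyLaplace c p := by
  induction p using Polynomial.induction_on' with
  | add p q hp hq =>
    simp only [eval_add, add_mul, map_add]
    rw [integral_add (integrableOn_eval_mul_exp_neg_mul_Ioi hc p)
      (integrableOn_eval_mul_exp_neg_mul_Ioi hc q), hp, hq]
  | monomial k a =>
    simp only [eval_monomial, mul_assoc]
    rw [integral_const_mul, integral_pow_mul_exp_neg_mul_Ioi hc, polyLaplace_monomial, mul_comm]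

theorem polyLaplace_mul_self_nonneg {c : ℝ} (hc : 0 < c) (p : ℝ[X]) :
    0 ≤ polyLaplace c (p * p) := by
  rw [← integral_eval_mul_exp_neg_mul_Ioi hc]
  refine integral_nonneg fun x => ?_
  rw [eval_mul]
  exact mul_nonneg (mul_self_nonneg _) (Real.exp_pos _).le

theorem integral_exp_neg_sub_eval_sq (p : ℝ[X]) :
    ∫ x in Set.Ioi (0 : ℝ), (Real.exp (-x) - p.eval x) ^ 2 * Real.exp (-x) =
      1 / 3 - 2 * polyLaplace 2 p + polyLaplace 1 (p * p) := by
  have h1 := integrableOn_eval_mul_exp_neg_mul_Ioi (c := 3) (by norm_num) 1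
  have h2 := (integrableOn_eval_mul_exp_neg_mul_Ioi (c := 2) (by norm_num) p).const_mul 2
  have h3 := integrableOn_eval_mul_exp_neg_mul_Ioi (c := 1) (by norm_num) (p * p)
  have e (x : ℝ) : (Real.exp (-x) - p.eval x) ^ 2 * Real.exp (-x) =
      (1 : ℝ[X]).eval x * Real.exp (-(3 * x)) - 2 * (p.eval x * Real.exp (-(2 * x))) +
        (p * p).eval x * Real.exp (-(1 * x)) := by
    have e3 : Real.exp (-(3 * x)) = Real.exp (-x) ^ 3 := by rw [← Real.exp_nat_mul]; congr 1; ring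
    have e2 : Real.exp (-(2 * x)) = Real.exp (-x) ^ 2 := by rw [← Real.exp_nat_mul]; congr 1; ring
    rw [e3, e2, eval_one, eval_mul, one_mul x]
    ring
  simp only [e]
  rw [integral_add (by exact Integrable.sub h1 h2) h3, integral_sub h1 h2, integral_const_mul,
    integral_eval_mul_exp_neg_mul_Ioi (by norm_num), integral_eval_mul_exp_neg_mul_Ioi (by norm_num),
    integral_eval_mul_exp_neg_mul_Ioi (by norm_num), ← monomial_zero_one, polyLaplace_monomial]
  norm_num

theorem sum_neg_one_pow_mul_choose_succ (k : ℕ) (f : ℕ → ℝ) :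
    ∑ j ∈ range (k + 2), (-1 : ℝ) ^ j * (k + 1).choose j * f j =
      ∑ j ∈ range (k + 1), (-1 : ℝ) ^ j * k.choose j * (f j - f (j + 1)) := by
  have h : ∑ j ∈ range (k + 1), (-1 : ℝ) ^ j * k.choose j * f j =
      ∑ j ∈ range (k + 1), (-1 : ℝ) ^ (j + 1) * k.choose (j + 1) * f (j + 1) + f 0 := by
    have h' := Finset.sum_range_succ' (fun j => (-1 : ℝ) ^ j * k.choose j * f j) (k + 1)
    rw [Finset.sum_range_succ] at h'
    simpa using h'
  simp only [mul_sub, Finset.sum_sub_distrib]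
  rw [h, Finset.sum_range_succ']
  simp only [Nat.choose_succ_succ, Nat.cast_add, pow_zero, Nat.choose_zero_right, Nat.cast_one,
    mul_one, one_mul]
  rw [add_sub_right_comm, ← Finset.sum_sub_distrib]
  congr 1
  exact Finset.sum_congr rfl fun j _ => by ring

theorem sum_neg_one_pow_mul_choose_mul_choose_add (k : ℕ) :
    ∀ a m : ℕ, ∑ j ∈ range (k + 1), (-1 : ℝ) ^ j * k.choose j * (a + j).choose m =
      if k ≤ m then (-1) ^ k * (a.choose (m - k) : ℝ) else 0 := by
  induction k with
  | zero => simp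
  | succ k ih =>
    intro a m
    rw [sum_neg_one_pow_mul_choose_succ k fun j => ((a + j).choose m : ℝ)]
    cases m with
    | zero => simp
    | succ m =>
      have e (j : ℕ) : ((a + j).choose (m + 1) : ℝ) - (a + (j + 1)).choose (m + 1) =
          -((a + j).choose m : ℝ) := by
        rw [← add_assoc, Nat.choose_succ_succ]; push_cast; ring
      simp only [e, mul_neg, Finset.sum_neg_distrib, ih, Nat.add_le_add_iff_right,
        Nat.add_sub_add_right]
      split_ifs <;> ring

theorem sum_neg_one_pow_mul_choose_mul_choose_add_self (k m : ℕ) :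
    ∑ j ∈ range (k + 1), (-1 : ℝ) ^ j * k.choose j * (m + j).choose m =
      (-1) ^ k * (m.choose k : ℝ) := by
  rw [sum_neg_one_pow_mul_choose_mul_choose_add]
  split_ifs with h
  · rw [Nat.choose_symm h]
  · rw [Nat.choose_eq_zero_of_lt (not_le.mp h)]; simp

/-- The `k`-th Laguerre polynomial. -/
noncomputable def laguerrePoly (k : ℕ) : ℝ[X] :=
  ∑ j ∈ range (k + 1), monomial j ((-1 : ℝ) ^ j * k.choose j / j.factorial)

theorem natDegree_laguerrePoly_le (k : ℕ) : (laguerrePoly k).natDegree ≤ k :=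
  natDegree_sum_le_of_forall_le _ _ fun _ hj =>
    (natDegree_monomial_le _).trans (Nat.lt_succ_iff.mp (mem_range.mp hj))

theorem polyLaplace_one_laguerrePoly_mul_monomial (k m : ℕ) (a : ℝ) :
    polyLaplace 1 (laguerrePoly k * monomial m a) =
      (-1) ^ k * m.choose k * (m.factorial * a) := by
  rw [← sum_neg_one_pow_mul_choose_mul_choose_add_self, laguerrePoly, Finset.sum_mul, map_sum,
    Finset.sum_mul]
  refine Finset.sum_congr rfl fun j _ => ?_
  rw [monomial_mul_monomial, polyLaplace_monomial, add_comm j m, Nat.choose_symm_add,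
    ← Nat.add_choose_mul_factorial_mul_factorial m j]
  have := Nat.factorial_ne_zero j
  push_cast
  field_simp
  simp

theorem polyLaplace_two_laguerrePoly (k : ℕ) :
    polyLaplace 2 (laguerrePoly k) = (1 / 2) ^ (k + 1) := by
  have h := add_pow (-1 / 2 : ℝ) 1 k
  rw [show (-1 / 2 : ℝ) + 1 = 1 / 2 by norm_num] at h
  rw [pow_succ, h, laguerrePoly, map_sum, Finset.sum_mul]
  refine Finset.sum_congr rfl fun j _ => ?_
  have := Nat.factorial_ne_zero j
  rw [polyLaplace_monomial, div_pow, one_pow]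
  field_simp
  ring

/-- The orthogonal projection of `e^{-x}` onto polynomials of degree `< n` in
`L²((0,∞), e^{-x}dx)`. -/
noncomputable def expProj (n : ℕ) : ℝ[X] :=
  ∑ k ∈ range n, (1 / 2 : ℝ) ^ (k + 1) • laguerrePoly k

theorem natDegree_expProj_le (n : ℕ) : (expProj n).natDegree ≤ n - 1 :=
  natDegree_sum_le_of_forall_le _ _ fun k hk =>
    (natDegree_smul_le _ _).trans
      ((natDegree_laguerrePoly_le k).trans (Nat.le_sub_one_of_lt (mem_range.mp hk)))

theorem polyLaplace_two_expProj (n : ℕ) :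
    polyLaplace 2 (expProj n) = 1 / 3 - 1 / (3 * 4 ^ n) := by
  simp only [expProj, map_sum, map_smul, polyLaplace_two_laguerrePoly, smul_eq_mul, ← mul_pow]
  induction n with
  | zero => norm_num
  | succ n ih =>
    rw [Finset.sum_range_succ, ih, show (1 / 2 * (1 / 2) : ℝ) = 1 / 4 by norm_num, div_pow, one_pow]
    field_simp
    ring

theorem polyLaplace_one_expProj_mul_monomial {n m : ℕ} (h : m < n) (a : ℝ) :
    polyLaplace 1 (expProj n * monomial m a) = polyLaplace 2 (monomial m a) := by
  have hb := add_pow (-1 / 2 : ℝ) 1 m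
  rw [show (-1 / 2 : ℝ) + 1 = 1 / 2 by norm_num] at hb
  have hs : ∑ k ∈ range n, (1 / 2 : ℝ) ^ (k + 1) * ((-1) ^ k * m.choose k) =
      (1 / 2) ^ (m + 1) := by
    rw [← Finset.sum_subset (Finset.range_mono (Nat.succ_le_of_lt h)), pow_succ, hb,
      Finset.sum_mul]
    · refine Finset.sum_congr rfl fun k _ => ?_
      rw [show (-1 / 2 : ℝ) = -1 * (1 / 2) by norm_num, mul_pow, one_pow]
      ring
    · intro k _ hk
      rw [Nat.choose_eq_zero_of_lt (by simpa using hk)]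
      simp
  simp only [expProj, Finset.sum_mul, smul_mul_assoc, map_sum, map_smul, smul_eq_mul,
    polyLaplace_one_laguerrePoly_mul_monomial, polyLaplace_monomial]
  simp only [← mul_assoc _ _ ((m.factorial : ℝ) * a)]
  rw [← Finset.sum_mul, hs, div_pow, one_pow]
  ring

theorem polyLaplace_one_expProj_mul {n : ℕ} {r : ℝ[X]} (hr : r.natDegree < n) :
    polyLaplace 1 (expProj n * r) = polyLaplace 2 r := by
  rw [r.as_sum_range' n hr, Finset.mul_sum, map_sum, map_sum]
  exact Finset.sum_congr rfl fun m hm =>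
    polyLaplace_one_expProj_mul_monomial (mem_range.mp hm) _

theorem integral_exp_neg_sub_eval_sq_eq {n : ℕ} {p : ℝ[X]} (hp : p.natDegree < n) :
    ∫ x in Set.Ioi (0 : ℝ), (Real.exp (-x) - p.eval x) ^ 2 * Real.exp (-x) =
      1 / (3 * 4 ^ n) + polyLaplace 1 ((p - expProj n) * (p - expProj n)) := by
  have hq : (expProj n).natDegree < n := by have := natDegree_expProj_le n; lia
  have h1 := polyLaplace_one_expProj_mul hq
  have h2 := polyLaplace_one_expProj_mul hp
  rw [integral_exp_neg_sub_eval_sq, show (p - expProj n) * (p - expProj n) =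
    p * p - (expProj n * p + expProj n * p) + expProj n * expProj n by ring]
  simp only [map_add, map_sub, h1, h2, polyLaplace_two_expProj]
  ring


/-- The squared `L²((0,∞), e^{-x}dx)` distance from `e^{-x}` to the polynomials of degree
at most `n − 1` is `4^{-n}/3`: the infimum of the error variances
`∫₀^∞ (e^{-x} − p(x))² e^{-x} dx` over polynomials `p` of degree at most `n − 1` equals
`1/(3 ⬝ 4ⁿ)`. -/
theorem exp_best_polynomial_error (n : ℕ) (hn : 1 ≤ n) :
    sInf {v : ℝ | ∃ p : Polynomial ℝ, p.natDegree ≤ n - 1 ∧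
        v = ∫ x in Set.Ioi (0 : ℝ), (Real.exp (-x) - p.eval x) ^ 2 * Real.exp (-x)} =
      1 / (3 * 4 ^ n) := by
  refine IsLeast.csInf_eq ⟨⟨expProj n, natDegree_expProj_le n, ?_⟩, ?_⟩
  · have hq : (expProj n).natDegree < n := by have := natDegree_expProj_le n; lia
    rw [integral_exp_neg_sub_eval_sq_eq hq]
    simp
  · rintro v ⟨p, hp, rfl⟩
    rw [integral_exp_neg_sub_eval_sq_eq (by lia : p.natDegree < n)]
    exact le_add_of_nonneg_right (polyLaplace_mul_self_nonneg one_pos _)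
end
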